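/- Let g be a finite-dimensional Lie algebra over a field K and let r = Σ_i a_i ⊗ b_i ∈ g ⊗ g be antisymmetric (its image under the flip of tensor factors equals −r) and satisfy the classical Yang–Baxter equation CYB(r) = 0. Then the dual bracket [f,φ]♯(x) = Σ_i (f([a_i,x]) φ(b_i) + f(a_i) φ([b_i,x])) makes the dual space g* into a Lie algebra: [·,·]♯ is bilinear, alternating ([f,f]♯ = 0 for all f ∈ g*), and satisfies the Jacobi identity. -/

import Mathlib

open scoped TensorProduct

/-- The classical Yang–Baxter expression `CYB(r)` for
`r = Σᵢ aᵢ ⊗ bᵢ ∈ g ⊗ g` (given by the finite families `a b : Fin n → g`). -/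
noncomputable def cyb {K g : Type*} [Field K] [LieRing g] [LieAlgebra K g] {n : ℕ}
    (a b : Fin n → g) : g ⊗[K] (g ⊗[K] g) :=
  ∑ i, ∑ j,
    (⁅a i, a j⁆ ⊗ₜ[K] (b i ⊗ₜ[K] b j) + a i ⊗ₜ[K] (⁅b i, a j⁆ ⊗ₜ[K] b j)
      + a i ⊗ₜ[K] (a j ⊗ₜ[K] ⁅b i, b j⁆))

/-- The dual bracket on `g*` induced by `r = Σᵢ aᵢ ⊗ bᵢ`:
`[f,φ]♯(x) = Σᵢ (f([aᵢ,x]) φ(bᵢ) + f(aᵢ) φ([bᵢ,x]))`. -/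
noncomputable def dualBracket {K g : Type*} [Field K] [LieRing g] [LieAlgebra K g] {n : ℕ}
    (a b : Fin n → g) (f φ : Module.Dual K g) : Module.Dual K g where
  toFun x := ∑ i, (f ⁅a i, x⁆ * φ (b i) + f (a i) * φ ⁅b i, x⁆)
  map_add' x y := by
    simp only [lie_add, map_add]
    rw [← Finset.sum_add_distrib]
    exact Finset.sum_congr rfl fun i _ => by ring
  map_smul' c x := by
    simp only [lie_smul, map_smul, smul_eq_mul, RingHom.id_apply]
    rw [Finset.mul_sum]
    exact Finset.sum_congr rfl fun i _ => by ring

section DualBracket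

variable {K g : Type*} [Field K] [LieRing g] [LieAlgebra K g] {n : ℕ} {a b : Fin n → g}

/-- The map `g* → g`, `φ ↦ Σᵢ φ(bᵢ) aᵢ`, attached to `r = Σᵢ aᵢ ⊗ bᵢ`. -/
def dualToLie (a b : Fin n → g) (φ : Module.Dual K g) : g :=
  ∑ i, φ (b i) • a i

theorem sum_smul_eq_neg_dualToLie
    (hskew : (∑ i, b i ⊗ₜ[K] a i) = - ∑ i, a i ⊗ₜ[K] b i) (φ : Module.Dual K g) :
    ∑ i, φ (a i) • b i = - dualToLie a b φ := by
  have h := congrArg (TensorProduct.lift ((LinearMap.lsmul K g ∘ₗ φ).flip)) hskew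
  simpa [dualToLie] using h

theorem apply_dualToLie_swap
    (hskew : (∑ i, b i ⊗ₜ[K] a i) = - ∑ i, a i ⊗ₜ[K] b i) (f φ : Module.Dual K g) :
    f (dualToLie a b φ) = - φ (dualToLie a b f) := by
  have h := congrArg φ (sum_smul_eq_neg_dualToLie hskew f)
  rw [map_neg] at h
  rw [← h]
  simp [dualToLie, mul_comm]

theorem dualBracket_apply_eq
    (hskew : (∑ i, b i ⊗ₜ[K] a i) = - ∑ i, a i ⊗ₜ[K] b i) (f φ : Module.Dual K g) (x : g) :
    dualBracket a b f φ x = f ⁅dualToLie a b φ, x⁆ - φ ⁅dualToLie a b f, x⁆ := by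
  have h : - φ ⁅dualToLie a b f, x⁆ = ∑ i, f (a i) * φ ⁅b i, x⁆ := by
    rw [← map_neg, ← neg_lie, ← sum_smul_eq_neg_dualToLie hskew f]
    simp [sum_lie]
  rw [sub_eq_add_neg, h]
  simp [dualBracket, dualToLie, sum_lie, Finset.sum_add_distrib, mul_comm]

theorem cyb_pairing
    (hskew : (∑ i, b i ⊗ₜ[K] a i) = - ∑ i, a i ⊗ₜ[K] b i) (hcybe : cyb (K := K) a b = 0)
    (f φ ψ : Module.Dual K g) :
    f ⁅dualToLie a b φ, dualToLie a b ψ⁆ - φ ⁅dualToLie a b f, dualToLie a b ψ⁆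
      + ψ ⁅dualToLie a b f, dualToLie a b φ⁆ = 0 := by
  have h := congrArg (TensorProduct.lift ((LinearMap.mul K K).compl₁₂ f
    (TensorProduct.lift ((LinearMap.mul K K).compl₁₂ φ ψ)))) hcybe
  have h₁ : f ⁅dualToLie a b φ, dualToLie a b ψ⁆
      = ∑ i, ∑ j, f ⁅a i, a j⁆ * (φ (b i) * ψ (b j)) := by
    simp only [dualToLie, sum_lie_sum, smul_lie, lie_smul, map_sum,
      map_smul, smul_eq_mul]
    exact Finset.sum_congr rfl fun i _ => Finset.sum_congr rfl fun j _ => by ring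
  have h₂ : - φ ⁅dualToLie a b f, dualToLie a b ψ⁆
      = ∑ i, ∑ j, f (a i) * (φ ⁅b i, a j⁆ * ψ (b j)) := by
    rw [← map_neg, ← neg_lie, ← sum_smul_eq_neg_dualToLie hskew f]
    simp only [dualToLie, sum_lie_sum, smul_lie, lie_smul, map_sum,
      map_smul, smul_eq_mul]
    exact Finset.sum_congr rfl fun i _ => Finset.sum_congr rfl fun j _ => by ring
  have h₃ : ψ ⁅dualToLie a b f, dualToLie a b φ⁆
      = ∑ i, ∑ j, f (a i) * (φ (a j) * ψ ⁅b i, b j⁆) := by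
    rw [← neg_neg ⁅dualToLie a b f, dualToLie a b φ⁆, ← neg_lie, ← lie_neg,
      ← sum_smul_eq_neg_dualToLie hskew f, ← sum_smul_eq_neg_dualToLie hskew φ]
    simp only [sum_lie_sum, smul_lie, lie_smul, map_sum,
      map_smul, smul_eq_mul]
    exact Finset.sum_congr rfl fun i _ => Finset.sum_congr rfl fun j _ => by ring
  rw [sub_eq_add_neg, h₁, h₂, h₃]
  simpa [cyb, Finset.sum_add_distrib] using h

theorem dualToLie_dualBracket
    (hskew : (∑ i, b i ⊗ₜ[K] a i) = - ∑ i, a i ⊗ₜ[K] b i) (hcybe : cyb (K := K) a b = 0)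
    (f φ : Module.Dual K g) :
    dualToLie a b (dualBracket a b f φ) = ⁅dualToLie a b f, dualToLie a b φ⁆ := by
  rw [← sub_eq_zero, ← Module.forall_dual_apply_eq_zero_iff K]
  intro ψ
  rw [map_sub, apply_dualToLie_swap hskew, dualBracket_apply_eq hskew]
  linear_combination -cyb_pairing hskew hcybe f φ ψ

theorem dualBracket_self
    (hskew : (∑ i, b i ⊗ₜ[K] a i) = - ∑ i, a i ⊗ₜ[K] b i) (f : Module.Dual K g) :
    dualBracket a b f f = 0 := by
  ext x
  simp [dualBracket_apply_eq hskew]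

theorem dualBracket_jacobi
    (hskew : (∑ i, b i ⊗ₜ[K] a i) = - ∑ i, a i ⊗ₜ[K] b i) (hcybe : cyb (K := K) a b = 0)
    (f φ ψ : Module.Dual K g) :
    dualBracket a b f (dualBracket a b φ ψ) + dualBracket a b φ (dualBracket a b ψ f)
      + dualBracket a b ψ (dualBracket a b f φ) = 0 := by
  ext x
  simp only [LinearMap.add_apply, LinearMap.zero_apply, dualBracket_apply_eq hskew,
    dualToLie_dualBracket hskew hcybe, lie_lie, map_sub]
  ring

end DualBracket

/-- if `r = Σᵢ aᵢ ⊗ bᵢ` is antisymmetric and satisfies the CYBE, then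
the dual bracket makes `g*` into a Lie algebra (bilinear, alternating, Jacobi). -/
theorem dualBracket_is_lie_bracket
    (K : Type*) (g : Type*) [Field K] [LieRing g] [LieAlgebra K g] [FiniteDimensional K g]
    {n : ℕ} (a b : Fin n → g)
    (hskew : (∑ i, b i ⊗ₜ[K] a i) = - ∑ i, a i ⊗ₜ[K] b i)
    (hcybe : cyb (K := K) a b = 0) :
    (∀ f₁ f₂ φ : Module.Dual K g,
        dualBracket a b (f₁ + f₂) φ = dualBracket a b f₁ φ + dualBracket a b f₂ φ)
    ∧ (∀ (c : K) (f φ : Module.Dual K g),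
        dualBracket a b (c • f) φ = c • dualBracket a b f φ)
    ∧ (∀ f φ₁ φ₂ : Module.Dual K g,
        dualBracket a b f (φ₁ + φ₂) = dualBracket a b f φ₁ + dualBracket a b f φ₂)
    ∧ (∀ (c : K) (f φ : Module.Dual K g),
        dualBracket a b f (c • φ) = c • dualBracket a b f φ)
    ∧ (∀ f : Module.Dual K g, dualBracket a b f f = 0)
    ∧ (∀ f φ ψ : Module.Dual K g,
        dualBracket a b f (dualBracket a b φ ψ)
          + dualBracket a b φ (dualBracket a b ψ f)
          + dualBracket a b ψ (dualBracket a b f φ) = 0) := by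
  refine ⟨fun f₁ f₂ φ => ?_, fun c f φ => ?_, fun f φ₁ φ₂ => ?_, fun c f φ => ?_,
    dualBracket_self hskew, dualBracket_jacobi hskew hcybe⟩ <;> ext x
  · simp only [dualBracket, LinearMap.coe_mk, AddHom.coe_mk, LinearMap.add_apply,
      ← Finset.sum_add_distrib]
    exact Finset.sum_congr rfl fun i _ => by ring
  · simp only [dualBracket, LinearMap.coe_mk, AddHom.coe_mk, LinearMap.smul_apply, smul_eq_mul,
      Finset.mul_sum]
    exact Finset.sum_congr rfl fun i _ => by ring
  · simp only [dualBracket, LinearMap.coe_mk, AddHom.coe_mk, LinearMap.add_apply,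
      ← Finset.sum_add_distrib]
    exact Finset.sum_congr rfl fun i _ => by ring
  · simp only [dualBracket, LinearMap.coe_mk, AddHom.coe_mk, LinearMap.smul_apply, smul_eq_mul,
      Finset.mul_sum]
    exact Finset.sum_congr rfl fun i _ => by ring
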